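/- Let Γ ↷ (X,μ) be a probability measure preserving action of a countable group Γ, let (Y,ρ) be a standard probability space, and consider the action Γ ↷ (X×Y, μ×ρ) given by g·(x,y) = (gx, y). Let w₁, w₂ : Γ × (X×Y) → Δ be cocycles into a countable group Δ, and for y ∈ Y and i ∈ {1,2} define the cocycle w_i^y : Γ × X → Δ by w_i^y(g,x) = w_i(g,(x,y)). Then ∫_Y d_μ(w₁^y, w₂^y) dρ(y) ≤ 4·d_{μ×ρ}(w₁,w₂). -/

import Mathlib

/- STATEMENT 6: Corollary 2.3 — averaging the uniform distance between two cocycles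
over the second (trivially acted upon) factor of a product action. -/

open MeasureTheory Filter Set Topology ENNReal

/-- A measurable cocycle for a nonsingular action, with values in a (countable) group. -/
def IsCocycleFor {I X Δ : Type*} [MeasurableSpace X] [Monoid I] [Mul Δ] (μ : Measure X)
    (act : I → X → X) (w : I → X → Δ) : Prop :=
  (∀ g (d : Δ), MeasurableSet {x | w g x = d}) ∧
  ∀ g₁ g₂ : I, ∀ᵐ x ∂μ, w (g₁ * g₂) x = w g₁ (act g₂ x) * w g₂ x

/-- The uniform distance `d_μ(w₁,w₂) = sup_g μ {x | w₁(g,x) ≠ w₂(g,x)}` between two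
cocycles. -/
noncomputable def cocycleDist {I X Δ : Type*} [MeasurableSpace X] (μ : Measure X)
    (w₁ w₂ : I → X → Δ) : ℝ≥0∞ :=
  ⨆ g : I, μ {x | w₁ g x ≠ w₂ g x}


/-- Minimal-norm argument: an almost invariant vector is close to an invariant one. -/
lemma exists_invariant_near {Γ H : Type*} [Group Γ] [NormedAddCommGroup H]
    [InnerProductSpace ℝ H] [CompleteSpace H] (U : Γ → H →ₗᵢ[ℝ] H) (ξ : H)
    (hU : ∀ g h, U h (U g ξ) = U (g * h) ξ) (r : ℝ) (hr : ∀ g, ‖U g ξ - ξ‖ ≤ r) :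
    ∃ η, (∀ g, U g η = η) ∧ ‖η - ξ‖ ≤ r := by
  set K : Set H := closedConvexHull ℝ (Set.range fun g => U g ξ) with hK
  have hKc : Convex ℝ K := convex_closedConvexHull
  have hKcl : IsClosed K := isClosed_closedConvexHull
  have hsub : (Set.range fun g => U g ξ) ⊆ K := subset_closedConvexHull
  obtain ⟨v, hv, hmin⟩ := exists_norm_eq_iInf_of_complete_convex
    (K := K) ⟨U 1 ξ, hsub ⟨1, rfl⟩⟩ hKcl.isComplete hKc 0
  rw [norm_eq_iInf_iff_real_inner_le_zero hKc hv] at hmin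
  refine ⟨v, fun h => ?_, ?_⟩
  · have hmem : K ⊆ (U h) ⁻¹' K := by
      refine closedConvexHull_min ?_ (hKc.linear_preimage (U h).toLinearMap)
        (hKcl.preimage (U h).continuous)
      rintro _ ⟨g, rfl⟩
      exact hsub ⟨g * h, (hU g h).symm⟩
    have h1 := hmin _ (hmem hv)
    have h2 : ‖U h v - v‖ ^ 2 ≤ 0 := by
      rw [norm_sub_sq_real, (U h).norm_map]
      rw [zero_sub, inner_neg_left, inner_sub_right, real_inner_self_eq_norm_sq,
        real_inner_comm] at h1
      linarith
    have h3 : ‖U h v - v‖ = 0 := by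
      have := sq_nonneg ‖U h v - v‖
      exact pow_eq_zero_iff (two_ne_zero) |>.1 (le_antisymm h2 this)
    exact sub_eq_zero.1 (norm_eq_zero.1 h3)
  · have : K ⊆ Metric.closedBall ξ r := by
      refine closedConvexHull_min ?_ (convex_closedBall _ _) Metric.isClosed_closedBall
      rintro _ ⟨g, rfl⟩
      simpa [dist_eq_norm] using hr g
    simpa [dist_eq_norm] using this hv

lemma lp_two_norm_sq {M : Type*} [MeasurableSpace M] {ν : Measure M} (u : Lp ℝ 2 ν) :
    ENNReal.ofReal (‖u‖ ^ 2) = ∫⁻ p, ‖u p‖ₑ ^ 2 ∂ν := by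
  have h := eLpNorm_nnreal_pow_eq_lintegral (f := u) (μ := ν) (p := 2) (by norm_num)
  rw [ENNReal.ofReal_pow (norm_nonneg _), Lp.norm_def, ENNReal.ofReal_toReal (Lp.eLpNorm_ne_top u)]
  simpa using h

lemma measurableSet_eq_fun_ctbl {Z Δ : Type*} [MeasurableSpace Z] [Countable Δ]
    [MeasurableSpace Δ] [MeasurableSingletonClass Δ] {u v : Z → Δ} (hu : Measurable u)
    (hv : Measurable v) : MeasurableSet {z | u z = v z} :=
  (hu.prodMk hv) (Set.to_countable {q : Δ × Δ | q.1 = q.2}).measurableSet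

lemma map_count_twist {Δ : Type*} [Group Δ] [Countable Δ] [MeasurableSpace Δ]
    [MeasurableSingletonClass Δ] (a b : Δ) :
    Measure.map (fun δ : Δ => a * δ * b⁻¹) Measure.count = Measure.count := by
  refine Measure.ext_of_singleton fun c => ?_
  rw [Measure.map_apply (measurable_of_countable _) (measurableSet_singleton c)]
  have : (fun δ : Δ => a * δ * b⁻¹) ⁻¹' {c} = {a⁻¹ * c * b} := by
    ext δ
    simp only [Set.mem_preimage, Set.mem_singleton_iff]
    constructor
    · rintro rfl; group
    · rintro rfl; group
  rw [this, Measure.count_singleton, Measure.count_singleton]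

open Classical in
/-- The indicator function of `Z × {1}`. -/
noncomputable def xiFun {Z Δ : Type*} [Group Δ] (p : Z × Δ) : ℝ := if p.2 = 1 then 1 else 0

open Classical in
lemma xi_diff_sum {Δ : Type*} [Group Δ] [Countable Δ] (a b : Δ) :
    ∑' δ : Δ, ‖(if a * δ * b⁻¹ = 1 then (1 : ℝ) else 0) - (if δ = 1 then 1 else 0)‖ₑ ^ 2
      ≤ if a ≠ b then 2 else 0 := by
  by_cases hab : a = b
  · subst hab
    have : ∀ δ : Δ, a * δ * a⁻¹ = 1 ↔ δ = 1 := fun δ => conj_eq_one_iff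
    simp [this]
  · rw [if_pos hab]
    calc _ ≤ ∑' δ : Δ, ((if δ = a⁻¹ * b then (1 : ℝ≥0∞) else 0) + (if δ = 1 then 1 else 0)) := by
          refine ENNReal.tsum_le_tsum fun δ => ?_
          have h1 : a * δ * b⁻¹ = 1 ↔ δ = a⁻¹ * b := by
            rw [mul_inv_eq_one, eq_inv_mul_iff_mul_eq]
          simp only [h1]
          by_cases h2 : δ = 1 <;> by_cases h3 : δ = a⁻¹ * b
          · rw [if_pos h2, if_pos h3, if_pos h2, if_pos h3]; simp
          · rw [if_pos h2, if_neg h3, if_pos h2, if_neg h3]; simp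
          · rw [if_neg h2, if_pos h3, if_neg h2, if_pos h3]; simp
          · rw [if_neg h2, if_neg h3, if_neg h2, if_neg h3]; simp
      _ = 2 := by
          rw [ENNReal.tsum_add, tsum_ite_eq, tsum_ite_eq]; norm_num

lemma exists_invariant_fun {Z Γ Δ : Type*} [MeasurableSpace Z] [Group Γ] [Group Δ] [Countable Δ]
    [MeasurableSpace Δ] [MeasurableSingletonClass Δ] (m : Measure Z) [IsProbabilityMeasure m]
    (S : Γ → Z → Z) (hS : ∀ g, MeasurePreserving (S g) m m)
    (hSm : ∀ g h z, S (g * h) z = S g (S h z)) (w₁ w₂ : Γ → Z → Δ)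
    (hm₁ : ∀ g, Measurable (w₁ g)) (hm₂ : ∀ g, Measurable (w₂ g))
    (hw₁ : ∀ g h, ∀ᵐ z ∂m, w₁ (g * h) z = w₁ g (S h z) * w₁ h z)
    (hw₂ : ∀ g h, ∀ᵐ z ∂m, w₂ (g * h) z = w₂ g (S h z) * w₂ h z) :
    ∃ F : Z × Δ → ℝ, Measurable F ∧
      (∀ g, ∀ᵐ z ∂m, ∀ δ, F (S g z, w₁ g z * δ * (w₂ g z)⁻¹) = F (z, δ)) ∧
      ∫⁻ p, ‖F p - xiFun p‖ₑ ^ 2 ∂(m.prod Measure.count) ≤ 2 * cocycleDist m w₁ w₂ := by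
  classical
  set ν : Measure (Z × Δ) := m.prod Measure.count with hν
  let T : Γ → Z × Δ → Z × Δ := fun g p => (S g p.1, w₁ g p.1 * p.2 * (w₂ g p.1)⁻¹)
  have hT : ∀ g, MeasurePreserving (T g) ν ν := by
    intro g
    refine (hS g).skew_product (g := fun z δ => w₁ g z * δ * (w₂ g z)⁻¹) ?_
      (Filter.Eventually.of_forall fun z => map_count_twist _ _)
    have : Measurable fun q : Δ × Δ × Δ => q.1 * q.2.1 * q.2.2⁻¹ := measurable_of_countable _
    exact this.comp (((hm₁ g).comp measurable_fst).prodMk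
      (measurable_snd.prodMk ((hm₂ g).comp measurable_fst)))
  have hTT : ∀ g h, T g ∘ T h =ᵐ[ν] T (g * h) := by
    intro g h
    have h0 : ∀ᵐ z ∂m, w₁ (g * h) z = w₁ g (S h z) * w₁ h z ∧
        w₂ (g * h) z = w₂ g (S h z) * w₂ h z := (hw₁ g h).and (hw₂ g h)
    have h1 := (Measure.quasiMeasurePreserving_fst (μ := m)
      (ν := (Measure.count : Measure Δ))).ae h0
    filter_upwards [h1] with p hp
    simp only [T, Function.comp, hp.1, hp.2, hSm, mul_inv_rev, mul_assoc]
  have hxm : Measurable (xiFun : Z × Δ → ℝ) :=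
    Measurable.ite (measurable_snd (measurableSet_singleton 1)) measurable_const measurable_const
  have hxL : MemLp (xiFun : Z × Δ → ℝ) 2 ν := by
    have : (xiFun : Z × Δ → ℝ) = (Set.univ ×ˢ {1} : Set (Z × Δ)).indicator fun _ => 1 := by
      ext p; simp [xiFun, Set.indicator_apply]
    rw [this]
    refine memLp_indicator_const 2 (MeasurableSet.univ.prod (measurableSet_singleton 1)) 1
      (Or.inr ?_)
    rw [hν, Measure.prod_prod]; simp
  let U : Γ → Lp ℝ 2 ν →ₗᵢ[ℝ] Lp ℝ 2 ν := fun g => Lp.compMeasurePreservingₗᵢ ℝ (T g) (hT g)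
  have hUc : ∀ g (u : Lp ℝ 2 ν), U g u =ᵐ[ν] u ∘ T g := fun g u =>
    Lp.coeFn_compMeasurePreserving u (hT g)
  let ξ : Lp ℝ 2 ν := hxL.toLp _
  have hξ : ξ =ᵐ[ν] xiFun := hxL.coeFn_toLp
  have hUU : ∀ g h, U h (U g ξ) = U (g * h) ξ := by
    intro g h
    refine Lp.ext ?_
    filter_upwards [hUc h (U g ξ), (hT h).quasiMeasurePreserving.ae (hUc g ξ), hUc (g * h) ξ,
      hTT g h] with p h1 h2 h3 h4
    rw [h1, h3, Function.comp, h2, Function.comp, Function.comp, ← h4, Function.comp]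
  have hDtop : cocycleDist m w₁ w₂ ≠ ∞ :=
    ne_top_of_le_ne_top one_ne_top (iSup_le fun g => prob_le_one)
  have hbd : ∀ g, ENNReal.ofReal (‖U g ξ - ξ‖ ^ 2) ≤ 2 * cocycleDist m w₁ w₂ := by
    intro g
    rw [lp_two_norm_sq]
    have e1 : ∫⁻ p, ‖(U g ξ - ξ : Lp ℝ 2 ν) p‖ₑ ^ 2 ∂ν
        = ∫⁻ p, ‖xiFun (T g p) - xiFun p‖ₑ ^ 2 ∂ν := by
      refine lintegral_congr_ae ?_
      filter_upwards [Lp.coeFn_sub (U g ξ) ξ, hUc g ξ, hξ,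
        (hT g).quasiMeasurePreserving.ae hξ] with p h1 h2 h3 h4
      rw [h1, Pi.sub_apply, h2, h3, Function.comp, h4]
    have hms : MeasurableSet {z | w₁ g z ≠ w₂ g z} :=
      (measurableSet_eq_fun_ctbl (hm₁ g) (hm₂ g)).compl
    rw [e1, hν, lintegral_prod _ (by
      exact (((hxm.comp (hT g).measurable).sub hxm).enorm.pow_const 2).aemeasurable)]
    calc _ ≤ ∫⁻ z, {z | w₁ g z ≠ w₂ g z}.indicator (fun _ => 2) z ∂m := by
          refine lintegral_mono fun z => ?_
          rw [lintegral_count]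
          refine (le_of_eq ?_).trans ((xi_diff_sum (w₁ g z) (w₂ g z)).trans (le_of_eq ?_))
          · refine tsum_congr fun δ => ?_
            simp only [xiFun, T]
          · simp only [Set.indicator_apply, Set.mem_setOf_eq]
      _ = 2 * m {z | w₁ g z ≠ w₂ g z} := by rw [lintegral_indicator_const hms]
      _ ≤ _ := by gcongr; exact le_iSup (fun g => m {z | w₁ g z ≠ w₂ g z}) g
  have h2D : 2 * cocycleDist m w₁ w₂ ≠ ∞ := ENNReal.mul_ne_top (by norm_num) hDtop
  obtain ⟨η, hη, hηr⟩ := exists_invariant_near U ξ hUU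
    (Real.sqrt (2 * cocycleDist m w₁ w₂).toReal) (fun g => by
      refine Real.le_sqrt_of_sq_le ?_
      exact (ENNReal.ofReal_le_iff_le_toReal h2D).1 (hbd g))
  obtain ⟨F, hF, hηF⟩ : ∃ F : Z × Δ → ℝ, Measurable F ∧ η =ᵐ[ν] F :=
    ⟨_, (Lp.stronglyMeasurable η).measurable, Filter.EventuallyEq.rfl⟩
  refine ⟨F, hF, fun g => ?_, ?_⟩
  · have h1 : ∀ᵐ p ∂ν, F (T g p) = F p := by
      have := hUc g η
      rw [hη g] at this
      filter_upwards [this, hηF, (hT g).quasiMeasurePreserving.ae hηF] with p h1 h2 h3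
      rw [← h3, ← h2, h1, Function.comp]
    filter_upwards [Measure.ae_ae_of_ae_prod h1] with z hz
    rwa [Measure.ae_count_iff] at hz
  · have e1 : ∫⁻ p, ‖F p - xiFun p‖ₑ ^ 2 ∂ν = ∫⁻ p, ‖(η - ξ : Lp ℝ 2 ν) p‖ₑ ^ 2 ∂ν := by
      refine lintegral_congr_ae ?_
      filter_upwards [Lp.coeFn_sub η ξ, hξ, hηF] with p h1 h2 h3
      rw [h1, Pi.sub_apply, h2, h3]
    rw [e1, ← lp_two_norm_sq, ENNReal.ofReal_le_iff_le_toReal h2D]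
    calc ‖η - ξ‖ ^ 2 ≤ (Real.sqrt (2 * cocycleDist m w₁ w₂).toReal) ^ 2 := by gcongr
      _ = _ := Real.sq_sqrt ENNReal.toReal_nonneg

lemma enorm_sq_ineq (t : ℝ) : (1 : ℝ≥0∞) ≤ 2 * (‖t - 1‖ₑ ^ 2 + ‖t‖ₑ ^ 2) := by
  have h : (1 : ℝ) ≤ 2 * (|t - 1| ^ 2 + |t| ^ 2) := by
    rw [sq_abs, sq_abs]; nlinarith [sq_nonneg (2 * t - 1)]
  have := ENNReal.ofReal_le_ofReal h
  rw [ENNReal.ofReal_mul (by norm_num), ENNReal.ofReal_add (by positivity) (by positivity),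
    ENNReal.ofReal_pow (abs_nonneg _), ENNReal.ofReal_pow (abs_nonneg _)] at this
  simpa [← Real.norm_eq_abs, ofReal_norm] using this

theorem cocycleDist_average_product
    {X : Type*} [MeasurableSpace X] {Γ : Type*} [Group Γ] [Countable Γ]
    [MulAction Γ X]
    -- Γ ↷ (X, μ) is a probability measure preserving action
    (μ : Measure X) [IsProbabilityMeasure μ]
    (hmeas : ∀ g : Γ, Measurable (fun x : X => g • x))
    (hpmp : ∀ g : Γ, MeasurePreserving (fun x : X => g • x) μ μ)
    -- (Y, ρ) is a standard probability space
    {Y : Type*} [MeasurableSpace Y] [StandardBorelSpace Y]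
    (ρ : Measure Y) [IsProbabilityMeasure ρ]
    -- w₁, w₂ : cocycles for the action g·(x,y) = (gx,y) on (X × Y, μ × ρ), into a
    -- countable group Δ
    {Δ : Type*} [Group Δ] [Countable Δ]
    (w₁ w₂ : Γ → X × Y → Δ)
    (hw₁ : IsCocycleFor (μ.prod ρ) (fun (g : Γ) (q : X × Y) => (g • q.1, q.2)) w₁)
    (hw₂ : IsCocycleFor (μ.prod ρ) (fun (g : Γ) (q : X × Y) => (g • q.1, q.2)) w₂) :
    -- ∫_Y d_μ(w₁^y, w₂^y) dρ(y) ≤ 4 d_{μ×ρ}(w₁, w₂), where w_i^y(g,x) = w_i(g,(x,y))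
    (∫⁻ y, cocycleDist μ (fun (g : Γ) (x : X) => w₁ g (x, y))
        (fun (g : Γ) (x : X) => w₂ g (x, y)) ∂ρ)
      ≤ 4 * cocycleDist (μ.prod ρ) w₁ w₂ := by
  classical
  let : MeasurableSpace Δ := ⊤
  have : MeasurableSingletonClass Δ := ⟨fun _ => trivial⟩
  have hm₁ : ∀ g, Measurable (w₁ g) := fun g => measurable_to_countable' fun d => hw₁.1 g d
  have hm₂ : ∀ g, Measurable (w₂ g) := fun g => measurable_to_countable' fun d => hw₂.1 g d
  obtain ⟨F, hF, hinv, hint⟩ := exists_invariant_fun (μ.prod ρ)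
    (fun (g : Γ) (q : X × Y) => (g • q.1, q.2))
    (fun g => (hpmp g).prod (MeasurePreserving.id ρ))
    (fun g h z => by simp [mul_smul]) w₁ w₂ hm₁ hm₂ hw₁.2 hw₂.2
  have hxm : Measurable (xiFun : (X × Y) × Δ → ℝ) :=
    Measurable.ite (measurable_snd (measurableSet_singleton 1)) measurable_const measurable_const
  have hG : Measurable fun p : (X × Y) × Δ => ‖F p - xiFun p‖ₑ ^ 2 :=
    (hF.sub hxm).enorm.pow_const 2
  -- the two parts of the fibrewise squared distance
  let A : X × Y → ℝ≥0∞ := fun z => ‖F (z, 1) - 1‖ₑ ^ 2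
  let B : X × Y → ℝ≥0∞ := fun z => ∑' δ : Δ, if δ = 1 then 0 else ‖F (z, δ)‖ₑ ^ 2
  have hFδ : ∀ δ : Δ, Measurable fun z : X × Y => F (z, δ) := fun δ =>
    hF.comp (measurable_id.prodMk measurable_const)
  have hA : Measurable A := ((hFδ 1).sub_const 1).enorm.pow_const 2
  have hB : Measurable B := by
    refine Measurable.ennreal_tsum fun δ => ?_
    by_cases h : δ = 1
    · simp [h]
    · simpa [h] using (hFδ δ).enorm.pow_const 2
  have hAB : ∀ z, ∑' δ : Δ, ‖F (z, δ) - xiFun (z, δ)‖ₑ ^ 2 = A z + B z := by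
    intro z
    have : A z = ∑' δ : Δ, if δ = 1 then A z else 0 := by rw [tsum_ite_eq]
    rw [this, ← ENNReal.tsum_add]
    refine tsum_congr fun δ => ?_
    by_cases h : δ = 1 <;> simp [h, xiFun, A]
  have hint' : ∫⁻ y, ∫⁻ x, (A (x, y) + B (x, y)) ∂μ ∂ρ ≤ 2 * cocycleDist (μ.prod ρ) w₁ w₂ := by
    refine le_trans (le_of_eq ?_) hint
    rw [lintegral_prod _ hG.aemeasurable]
    simp_rw [lintegral_count, hAB]
    exact (lintegral_prod_symm' (fun z => A z + B z) (hA.add hB)).symm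
  have hinvy : ∀ᵐ y ∂ρ, ∀ g, ∀ᵐ x ∂μ, ∀ δ,
      F ((g • x, y), w₁ g (x, y) * δ * (w₂ g (x, y))⁻¹) = F ((x, y), δ) := by
    rw [ae_all_iff]
    intro g
    have h := (Measure.measurePreserving_swap (μ := ρ) (ν := μ)).quasiMeasurePreserving.ae (hinv g)
    exact Measure.ae_ae_of_ae_prod h
  have key : ∀ᵐ y ∂ρ, cocycleDist μ (fun (g : Γ) (x : X) => w₁ g (x, y))
      (fun (g : Γ) (x : X) => w₂ g (x, y)) ≤ 2 * ∫⁻ x, (A (x, y) + B (x, y)) ∂μ := by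
    filter_upwards [hinvy] with y hy
    refine iSup_le fun g => ?_
    have hAy : Measurable fun x => A (x, y) := hA.comp (measurable_id.prodMk measurable_const)
    have hBy : Measurable fun x => B (x, y) := hB.comp (measurable_id.prodMk measurable_const)
    have hms : MeasurableSet {x | w₁ g (x, y) ≠ w₂ g (x, y)} :=
      (measurableSet_eq_fun_ctbl
        ((hm₁ g).comp (measurable_id.prodMk measurable_const))
        ((hm₂ g).comp (measurable_id.prodMk measurable_const))).compl
    calc μ {x | w₁ g (x, y) ≠ w₂ g (x, y)}
        = ∫⁻ x, {x | w₁ g (x, y) ≠ w₂ g (x, y)}.indicator 1 x ∂μ := by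
          rw [lintegral_indicator_one hms]
      _ ≤ ∫⁻ x, 2 * (A (x, y) + B (g • x, y)) ∂μ := by
          refine lintegral_mono_ae ?_
          filter_upwards [hy g] with x hx
          by_cases hne : w₁ g (x, y) = w₂ g (x, y)
          · simp [hne]
          · have hne' : w₁ g (x, y) * 1 * (w₂ g (x, y))⁻¹ ≠ 1 := by
              rw [mul_one, Ne, mul_inv_eq_one]; exact hne
            have hBge : ‖F ((x, y), 1)‖ₑ ^ 2 ≤ B (g • x, y) := by
              rw [← hx 1]
              refine le_trans (le_of_eq ?_)
                (ENNReal.le_tsum (w₁ g (x, y) * 1 * (w₂ g (x, y))⁻¹))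
              rw [if_neg hne']
            refine le_trans (le_trans (le_of_eq ?_) (enorm_sq_ineq (F ((x, y), 1)))) ?_
            · rw [Set.indicator_of_mem (by exact hne)]; rfl
            · gcongr
      _ = 2 * ∫⁻ x, (A (x, y) + B (x, y)) ∂μ := by
          have hBg : Measurable fun x => A (x, y) + B (g • x, y) := hAy.add (hBy.comp (hmeas g))
          rw [lintegral_const_mul _ hBg, lintegral_add_left hAy,
            lintegral_add_left hAy, (hpmp g).lintegral_comp hBy]
  calc _ ≤ ∫⁻ y, 2 * ∫⁻ x, (A (x, y) + B (x, y)) ∂μ ∂ρ := lintegral_mono_ae key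
    _ = 2 * ∫⁻ y, ∫⁻ x, (A (x, y) + B (x, y)) ∂μ ∂ρ :=
        lintegral_const_mul _ (hA.add hB).lintegral_prod_left'
    _ ≤ 2 * (2 * cocycleDist (μ.prod ρ) w₁ w₂) := by gcongr
    _ = _ := by rw [← mul_assoc]; norm_num
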